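/- In the stratified case p_{n,k} = p_n, if s_n = ∑_{k=1}^n p_k(1−p_k) → ∞, then for all 0 < x ≤ y < 1, (n/√s_n)·g_n([x,y]) → Q(y) − Q(x), where Q is the standard normal quantile function. -/

import Mathlib

open Filter Topology

/-- The standard normal cumulative distribution function `Φ`. -/
noncomputable def stdGaussianCDF (t : ℝ) : ℝ :=
  (ProbabilityTheory.gaussianReal 0 1 (Set.Iic t)).toReal

/-- The standard normal quantile function `Q = Φ⁻¹`. -/
noncomputable def stdGaussianQuantile : ℝ → ℝ :=
  Function.invFun stdGaussianCDF

open MeasureTheory ProbabilityTheory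

namespace Strat

noncomputable def nu (p : ℕ → ℝ) : ℕ → Measure ℝ
  | 0 => Measure.dirac 0
  | n + 1 => ENNReal.ofReal (1 - p (n + 1)) • nu p n +
      ENNReal.ofReal (p (n + 1)) • (nu p n).map (· + 1)

lemma nu_prob (p : ℕ → ℝ) (hp : ∀ n, p n ∈ Set.Icc (0 : ℝ) 1) (n : ℕ) :
    IsProbabilityMeasure (nu p n) := by
  induction n with
  | zero => unfold nu; infer_instance
  | succ n ih =>
    have : IsProbabilityMeasure ((nu p n).map (· + 1)) :=
      Measure.isProbabilityMeasure_map (by fun_prop)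
    constructor
    simp only [nu, Measure.add_apply, Measure.smul_apply, measure_univ, smul_eq_mul, mul_one]
    rw [← ENNReal.ofReal_add (by linarith [(hp (n+1)).2]) (hp (n+1)).1]
    simp

lemma nu_charFun (p : ℕ → ℝ) (hp : ∀ n, p n ∈ Set.Icc (0 : ℝ) 1) (n : ℕ) (t : ℝ) :
    charFun (nu p n) t
      = ∏ k ∈ Finset.Icc 1 n, ((1 - p k : ℂ) + p k * Complex.exp (t * Complex.I)) := by
  induction n with
  | zero => simp [nu, charFun_dirac]
  | succ n ih =>
    have h0 := nu_prob p hp n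
    have : IsProbabilityMeasure ((nu p n).map (· + 1)) :=
      Measure.isProbabilityMeasure_map (by fun_prop)
    have hi : ∀ μ : Measure ℝ, IsProbabilityMeasure μ →
        Integrable (fun x : ℝ => Complex.exp (t * x * Complex.I)) μ := by
      intro μ hμ
      refine (integrable_const (1:ℝ)).mono' (by fun_prop) (ae_of_all _ fun x => ?_)
      rw [← Complex.ofReal_mul, Complex.norm_exp_ofReal_mul_I]
    rw [Finset.prod_Icc_succ_top (by omega), ← ih, charFun_apply_real, nu,
      integral_add_measure ((hi _ h0).smul_measure (by simp)) ((hi _ this).smul_measure (by simp)),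
      integral_smul_measure, integral_smul_measure, ← charFun_apply_real, ← charFun_apply_real,
      charFun_map_add_const, ENNReal.toReal_ofReal (by linarith [(hp (n+1)).2]),
      ENNReal.toReal_ofReal (hp (n+1)).1]
    simp
    ring

lemma nu_rec (p : ℕ → ℝ) (hp : ∀ n, p n ∈ Set.Icc (0 : ℝ) 1) (n : ℕ) (x : ℝ) :
    (nu p (n+1)).real (Set.Iio x) = (1 - p (n+1)) * (nu p n).real (Set.Iio x)
      + p (n+1) * (nu p n).real (Set.Iio (x - 1)) := by
  have h0 := nu_prob p hp n
  have : IsProbabilityMeasure ((nu p n).map (· + 1)) :=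
      Measure.isProbabilityMeasure_map (by fun_prop)
  have e : (fun y : ℝ => y + 1) ⁻¹' (Set.Iio x) = Set.Iio (x - 1) := by
    ext y; simp [lt_sub_iff_add_lt]
  simp only [nu, measureReal_def, Measure.add_apply, Measure.smul_apply, smul_eq_mul]
  rw [Measure.map_apply (by fun_prop) measurableSet_Iio, e, ENNReal.toReal_add
    (ENNReal.mul_ne_top (by simp) (measure_ne_top _ _))
    (ENNReal.mul_ne_top (by simp) (measure_ne_top _ _)), ENNReal.toReal_mul, ENNReal.toReal_mul,
    ENNReal.toReal_ofReal (by linarith [(hp (n+1)).2]), ENNReal.toReal_ofReal (hp (n+1)).1]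

lemma nu_eq (p : ℕ → ℝ) (hp : ∀ n, p n ∈ Set.Icc (0 : ℝ) 1)
    (a : ℕ → ℕ → ℝ)
    (ha0 : ∀ n, a n 0 = 0) (ha1 : ∀ n, a n (n + 1) = 1)
    (harec : ∀ n k, 1 ≤ n → 1 ≤ k → k ≤ n →
      a n k = p n * a (n - 1) (k - 1) + (1 - p n) * a (n - 1) k) (n : ℕ) :
    ∀ k ≤ n + 1, a n k = (nu p n).real (Set.Iio (k : ℝ)) := by
  induction n with
  | zero =>
    intro k hk
    interval_cases k
    · simp [ha0, nu, measureReal_def]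
    · have := ha1 0
      simp [nu, measureReal_def] at *
      simpa using this
  | succ n ih =>
    intro k hk
    have := nu_prob p hp n
    rw [nu_rec p hp]
    rcases Nat.eq_zero_or_pos k with rfl | hk0
    · have h1 := ih 0 (by omega)
      have h2 : (nu p n).real (Set.Iio (((0:ℕ):ℝ) - 1)) ≤ (nu p n).real (Set.Iio ((0:ℕ):ℝ)) :=
        measureReal_mono (Set.Iio_subset_Iio (by simp))
      have h3 : 0 ≤ (nu p n).real (Set.Iio (((0:ℕ):ℝ) - 1)) := measureReal_nonneg
      rw [ha0] at h1
      rw [← h1] at h2 ⊢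
      rw [le_antisymm h2 h3, ha0]; ring
    · have e : ((k:ℝ) - 1) = ((k - 1 : ℕ) : ℝ) := by push_cast [Nat.cast_sub hk0]; rfl
      rw [e, ← ih (k-1) (by omega)]
      rcases Nat.lt_or_ge (n + 1) k with h | h
      · obtain rfl : k = n + 1 + 1 := by omega
        have h1 := ih (n+1) (by omega)
        have h2 : (nu p n).real (Set.Iio ((n + 1 : ℕ):ℝ)) ≤
            (nu p n).real (Set.Iio ((n + 1 + 1:ℕ):ℝ)) :=
          measureReal_mono (Set.Iio_subset_Iio (by push_cast; linarith))
        have h3 : (nu p n).real (Set.Iio ((n + 1 + 1:ℕ):ℝ)) ≤ 1 := measureReal_le_one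
        rw [← h1, ha1] at h2
        rw [le_antisymm h3 h2, ha1, Nat.add_sub_cancel, ha1]; ring
      · rw [← ih k h, harec (n+1) k (by omega) hk0 h]
        simp only [Nat.add_sub_cancel]; ring

lemma exp_three (x : ℝ) (hx : |x| ≤ 1) :
    ‖Complex.exp (x * Complex.I) - (1 + x * Complex.I - x^2/2)‖ ≤ |x|^3 := by
  have h := Complex.exp_bound (x := x * Complex.I) (by simpa using hx) (n := 3) (by norm_num)
  have e : ∑ m ∈ Finset.range 3, ((x:ℂ) * Complex.I)^m / (m.factorial : ℂ)
      = 1 + x * Complex.I - x^2/2 := by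
    simp [Finset.sum_range_succ, mul_pow, Nat.factorial]; ring
  rw [e] at h
  refine h.trans ?_
  simp only [norm_mul, Complex.norm_real, Complex.norm_I, mul_one, Real.norm_eq_abs]
  have : 0 ≤ |x|^3 := by positivity
  norm_num [Nat.factorial]
  linarith

lemma factor_bound (p θ : ℝ) (hp0 : 0 ≤ p) (hp1 : p ≤ 1) (hθ : |θ| ≤ 1) :
    ‖((1 - p : ℂ) + p * Complex.exp (θ * Complex.I)) * Complex.exp (-(p * θ : ℝ) * Complex.I)
      - Complex.exp (-(p * (1 - p) * θ^2 / 2 : ℝ))‖ ≤ 3 * (p * (1 - p)) * |θ|^3 := by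
  have q0 : 0 ≤ 1 - p := by linarith
  have hA : |-(p * θ)| = p * |θ| := by rw [abs_neg, abs_mul, abs_of_nonneg hp0]
  have hB : |(1 - p) * θ| = (1 - p) * |θ| := by rw [abs_mul, abs_of_nonneg q0]
  have t0 := abs_nonneg θ
  have h1 := exp_three (-(p * θ)) (by rw [hA]; nlinarith)
  have h2 := exp_three ((1 - p) * θ) (by rw [hB]; nlinarith)
  rw [hA] at h1
  rw [hB] at h2
  have hy0 : 0 ≤ p * (1 - p) * θ^2 / 2 := by positivity
  have hθ2 : θ^2 ≤ 1 := by rw [← sq_abs]; nlinarith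
  have hpq : p * (1 - p) ≤ 1 := by nlinarith
  have hpq0 : 0 ≤ p * (1 - p) := by positivity
  have hy1 : p * (1 - p) * θ^2 / 2 ≤ 1 := by nlinarith [sq_nonneg θ]
  have h3 : ‖Complex.exp (-(p * (1 - p) * θ^2 / 2 : ℝ)) - 1 - (-(p * (1 - p) * θ^2 / 2 : ℝ))‖
      ≤ (p * (1 - p) * θ^2 / 2)^2 := by
    have := Complex.norm_exp_sub_one_sub_id_le (x := (-(p * (1 - p) * θ^2 / 2 : ℝ) : ℂ))
      (by rw [norm_neg, Complex.norm_real, Real.norm_eq_abs, abs_of_nonneg hy0]; exact hy1)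
    rwa [norm_neg, Complex.norm_real, Real.norm_eq_abs, abs_of_nonneg hy0] at this
  have e : ((1 - p : ℂ) + p * Complex.exp (θ * Complex.I)) * Complex.exp (-(p * θ : ℝ) * Complex.I)
      = (1 - p) * Complex.exp ((-(p * θ) : ℝ) * Complex.I)
        + p * Complex.exp (((1 - p) * θ : ℝ) * Complex.I) := by
    have : Complex.exp (((1 - p) * θ : ℝ) * Complex.I) =
      Complex.exp (θ * Complex.I) * Complex.exp (-(p * θ : ℝ) * Complex.I) := by
      rw [← Complex.exp_add]; congr 1; push_cast; ring
    rw [this]; push_cast; ring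
  rw [e]
  set E1 := Complex.exp ((-(p * θ) : ℝ) * Complex.I)
  set E2 := Complex.exp (((1 - p) * θ : ℝ) * Complex.I)
  set E3 := Complex.exp (-(p * (1 - p) * θ^2 / 2 : ℝ))
  have key : (1 - p) * E1 + p * E2 - E3 =
      ((1 - p : ℝ) : ℂ) * (E1 - (1 + (-(p * θ) : ℝ) * Complex.I - ((-(p * θ) : ℝ) : ℂ)^2/2))
      + ((p : ℝ) : ℂ) * (E2 - (1 + ((1 - p) * θ : ℝ) * Complex.I - (((1 - p) * θ : ℝ) : ℂ)^2/2))
      - (E3 - 1 - (-(p * (1 - p) * θ^2 / 2 : ℝ))) := by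
    push_cast; ring
  rw [key]
  refine (norm_sub_le _ _).trans ?_
  refine (add_le_add (norm_add_le _ _) le_rfl).trans ?_
  rw [norm_mul, norm_mul, Complex.norm_real, Complex.norm_real, Real.norm_eq_abs,
    Real.norm_eq_abs, abs_of_nonneg hp0, abs_of_nonneg q0]
  have g1 := mul_le_mul_of_nonneg_left h1 q0
  have g2 := mul_le_mul_of_nonneg_left h2 hp0
  have hc : 0 ≤ |θ|^3 := by positivity
  have k1 : (1 - p) * (p * |θ|)^3 ≤ p * (1 - p) * |θ|^3 := by
    have : (1 - p) * (p * |θ|)^3 = (p * (1 - p) * |θ|^3) * p^2 := by ring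
    rw [this]; exact mul_le_of_le_one_right (by positivity) (by nlinarith)
  have k2 : p * ((1 - p) * |θ|)^3 ≤ p * (1 - p) * |θ|^3 := by
    have : p * ((1 - p) * |θ|)^3 = (p * (1 - p) * |θ|^3) * (1-p)^2 := by ring
    rw [this]; exact mul_le_of_le_one_right (by positivity) (by nlinarith)
  have k3 : (p * (1 - p) * θ^2 / 2)^2 ≤ p * (1 - p) * |θ|^3 := by
    have : (p * (1 - p) * θ^2 / 2)^2 = (p * (1 - p) * |θ|^3) * ((p * (1-p)) * |θ| / 4) := by
      rw [← sq_abs θ]; ring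
    rw [this]; exact mul_le_of_le_one_right (by positivity) (by nlinarith)
  linarith

lemma prod_diff (S : Finset ℕ) (f g : ℕ → ℂ) (e : ℕ → ℝ) (hf : ∀ i ∈ S, ‖f i‖ ≤ 1)
    (hg : ∀ i ∈ S, ‖g i‖ ≤ 1) (h : ∀ i ∈ S, ‖f i - g i‖ ≤ e i) :
    ‖∏ i ∈ S, f i - ∏ i ∈ S, g i‖ ≤ ∑ i ∈ S, e i := by
  classical
  induction S using Finset.induction_on with
  | empty => simp
  | insert i S hi ih =>
    rw [Finset.prod_insert hi, Finset.prod_insert hi, Finset.sum_insert hi]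
    have ih' := ih (fun j hj => hf j (Finset.mem_insert_of_mem hj))
      (fun j hj => hg j (Finset.mem_insert_of_mem hj))
      (fun j hj => h j (Finset.mem_insert_of_mem hj))
    have hP : ‖∏ i ∈ S, g i‖ ≤ 1 := by
      rw [norm_prod]
      exact Finset.prod_le_one (fun _ _ => norm_nonneg _)
        (fun j hj => hg j (Finset.mem_insert_of_mem hj))
    have h1 := hf i (Finset.mem_insert_self _ _)
    have h2 := h i (Finset.mem_insert_self _ _)
    calc _ = ‖f i * (∏ i ∈ S, f i - ∏ i ∈ S, g i) + (f i - g i) * ∏ i ∈ S, g i‖ := by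
          congr 1; ring
      _ ≤ ‖f i‖ * ‖∏ i ∈ S, f i - ∏ i ∈ S, g i‖ + ‖f i - g i‖ * ‖∏ i ∈ S, g i‖ := by
          rw [← norm_mul, ← norm_mul]; exact norm_add_le _ _
      _ ≤ 1 * ‖∏ i ∈ S, f i - ∏ i ∈ S, g i‖ + ‖f i - g i‖ * 1 := by gcongr
      _ ≤ _ := by linarith

noncomputable def mu (p : ℕ → ℝ) (n : ℕ) : ℝ := ∑ k ∈ Finset.Icc 1 n, p k

lemma tendsto_char (p : ℕ → ℝ) (hp : ∀ n, p n ∈ Set.Icc (0 : ℝ) 1)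
    (s : ℕ → ℝ) (hs : ∀ n, s n = ∑ k ∈ Finset.Icc 1 n, p k * (1 - p k))
    (hsinf : Tendsto s atTop atTop) (t : ℝ) :
    Tendsto (fun n => charFun (((nu p n).map (· + (-mu p n))).map ((Real.sqrt (s n))⁻¹ * ·)) t)
      atTop (𝓝 (charFun (gaussianReal 0 1) t)) := by
  have hsq : Tendsto (fun n => Real.sqrt (s n)) atTop atTop := Real.tendsto_sqrt_atTop.comp hsinf
  have hinv : Tendsto (fun n => (Real.sqrt (s n))⁻¹) atTop (𝓝 0) := hsq.inv_tendsto_atTop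
  have hθ : Tendsto (fun n => |(Real.sqrt (s n))⁻¹ * t|) atTop (𝓝 0) := by
    have := (hinv.mul_const t).abs
    simpa using this
  rw [tendsto_iff_norm_sub_tendsto_zero]
  have hb : Tendsto (fun n => 3 * |t|^2 * |(Real.sqrt (s n))⁻¹ * t|) atTop (𝓝 0) := by
    have := hθ.const_mul (3 * |t|^2)
    rwa [mul_zero] at this
  refine squeeze_zero' (Eventually.of_forall fun _ => norm_nonneg _) ?_ hb
  filter_upwards [hθ.eventually_le_const (zero_lt_one), hsinf.eventually_gt_atTop 0] with n h1 h2
  set θ := (Real.sqrt (s n))⁻¹ * t with hθd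
  have hsθ : s n * θ^2 = t^2 := by
    rw [hθd, mul_pow, inv_pow, Real.sq_sqrt h2.le]; field_simp
  have hc : charFun (((nu p n).map (· + (-mu p n))).map ((Real.sqrt (s n))⁻¹ * ·)) t
      = ∏ k ∈ Finset.Icc 1 n, (((1 - p k : ℂ) + p k * Complex.exp (θ * Complex.I))
        * Complex.exp (-(p k * θ : ℝ) * Complex.I)) := by
    rw [charFun_map_mul, charFun_map_add_const, nu_charFun p hp, Finset.prod_mul_distrib,
      ← Complex.exp_sum, ← hθd]
    congr 2
    simp only [mu, Real.inner_apply]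
    push_cast
    rw [← Finset.sum_mul, Finset.sum_neg_distrib, ← Finset.sum_mul]
    simp
  have hg : charFun (gaussianReal 0 1) t
      = ∏ k ∈ Finset.Icc 1 n, Complex.exp (-(p k * (1 - p k) * θ^2 / 2 : ℝ)) := by
    rw [charFun_gaussianReal, ← Complex.exp_sum]
    congr 1
    have : ∑ k ∈ Finset.Icc 1 n, (-((p k * (1 - p k) * θ^2 / 2 : ℝ) : ℂ)) =
      ((-(s n * θ^2 / 2) : ℝ) : ℂ) := by
      rw [hs, Finset.sum_mul, Finset.sum_div]
      push_cast
      rw [Finset.sum_neg_distrib]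
    rw [this, hsθ]
    push_cast
    simp
  rw [hc, hg]
  refine (prod_diff _ _ _ (fun k => 3 * (p k * (1 - p k)) * |θ|^3) ?_ ?_ ?_).trans ?_
  · intro k _
    rw [norm_mul]
    have e1 : ‖Complex.exp (-(p k * θ : ℝ) * Complex.I)‖ = 1 := by
      rw [← Complex.ofReal_neg, Complex.norm_exp_ofReal_mul_I]
    rw [e1, mul_one]
    refine (norm_add_le _ _).trans ?_
    rw [norm_mul, Complex.norm_exp_ofReal_mul_I, ← Complex.ofReal_one, ← Complex.ofReal_sub,
      Complex.norm_real, Complex.norm_real, Real.norm_eq_abs, Real.norm_eq_abs,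
      abs_of_nonneg (hp k).1, abs_of_nonneg (by linarith [(hp k).2])]
    linarith
  · intro k _
    rw [← Complex.ofReal_neg, ← Complex.ofReal_exp, Complex.norm_real, Real.norm_eq_abs,
      Real.abs_exp, Real.exp_le_one_iff]
    have := mul_nonneg (hp k).1 (sub_nonneg.2 (hp k).2)
    nlinarith [mul_nonneg this (sq_nonneg θ)]
  · intro k _
    exact factor_bound _ _ (hp k).1 (hp k).2 h1
  · rw [← Finset.sum_mul, ← Finset.mul_sum, ← hs]
    apply le_of_eq
    have : |t|^2 = s n * |θ|^2 := by rw [sq_abs, sq_abs, hsθ]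
    rw [this]; ring

lemma clt (p : ℕ → ℝ) (hp : ∀ n, p n ∈ Set.Icc (0 : ℝ) 1)
    (s : ℕ → ℝ) (hs : ∀ n, s n = ∑ k ∈ Finset.Icc 1 n, p k * (1 - p k))
    (hsinf : Tendsto s atTop atTop) (t : ℝ) :
    Tendsto (fun n => (nu p n).real (Set.Iic (mu p n + t * Real.sqrt (s n))))
      atTop (𝓝 (stdGaussianCDF t)) := by
  have hP : ∀ n, IsProbabilityMeasure
      (((nu p n).map (· + (-mu p n))).map ((Real.sqrt (s n))⁻¹ * ·)) := by
    intro n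
    have := nu_prob p hp n
    have : IsProbabilityMeasure ((nu p n).map (· + (-mu p n))) :=
      Measure.isProbabilityMeasure_map (by fun_prop)
    exact Measure.isProbabilityMeasure_map (by fun_prop)
  let M : ℕ → ProbabilityMeasure ℝ := fun n => ⟨_, hP n⟩
  let G : ProbabilityMeasure ℝ := ⟨gaussianReal 0 1, inferInstance⟩
  have hM : Tendsto M atTop (𝓝 G) :=
    ProbabilityMeasure.tendsto_iff_tendsto_charFun.2 fun t => tendsto_char p hp s hs hsinf t
  have hna := nullSingletonClass_gaussianReal (μ := 0) (v := 1) one_ne_zero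
  have h := ProbabilityMeasure.tendsto_measure_of_null_frontier_of_tendsto' hM (E := Set.Iic t)
    (by rw [frontier_Iic]; exact measure_singleton (μ := gaussianReal 0 1) t)
  have h' := (ENNReal.tendsto_toReal (measure_ne_top _ _)).comp h
  refine Tendsto.congr' ?_ h'
  filter_upwards [hsinf.eventually_gt_atTop 0] with n h2
  have hq := Real.sqrt_pos.2 h2
  simp only [Function.comp, M, ProbabilityMeasure.coe_mk, measureReal_def]
  rw [Measure.map_apply (by fun_prop) measurableSet_Iic, Measure.map_apply (by fun_prop)
    (measurableSet_Iic.preimage (by fun_prop))]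
  congr 2
  ext x
  simp only [Set.mem_preimage, Set.mem_Iic]
  rw [inv_mul_le_iff₀ hq]
  constructor <;> intro h <;> linarith

lemma cdf_strictMono : StrictMono stdGaussianCDF := by
  intro x y hxy
  have ho : (gaussianReal 0 1).IsOpenPosMeasure :=
    (gaussianReal_absolutelyContinuous' 0 one_ne_zero).isOpenPosMeasure
  have h1 : 0 < (gaussianReal 0 1) (Set.Ioo x y) := by
    exact isOpen_Ioo.measure_pos _ (Set.nonempty_Ioo.2 hxy)
  have h2 : 0 < (gaussianReal 0 1).real (Set.Ioc x y) :=
    ENNReal.toReal_pos (h1.trans_le (measure_mono Set.Ioo_subset_Ioc_self)).ne' (measure_ne_top _ _)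
  have h3 : (gaussianReal 0 1).real (Set.Iic y) = (gaussianReal 0 1).real (Set.Iic x)
      + (gaussianReal 0 1).real (Set.Ioc x y) := by
    rw [← measureReal_union _ measurableSet_Ioc, Set.Iic_union_Ioc_eq_Iic hxy.le]
    rw [Set.disjoint_left]; intro z hz hz'; exact absurd hz'.1 (not_lt.2 hz)
  change (gaussianReal 0 1).real (Set.Iic x) < (gaussianReal 0 1).real (Set.Iic y)
  linarith

lemma cdf_eq : stdGaussianCDF = cdf (gaussianReal 0 1) := by
  ext x; rw [cdf_eq_real]; rfl

lemma cdf_cont : Continuous stdGaussianCDF := by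
  have hna := nullSingletonClass_gaussianReal (μ := 0) (v := 1) one_ne_zero
  rw [cdf_eq, continuous_iff_continuousAt]
  intro x
  rw [(monotone_cdf _).continuousAt_iff_leftLim_eq_rightLim, StieltjesFunction.rightLim_eq]
  have h := (cdf (gaussianReal 0 1)).measure_singleton x
  rw [measure_cdf, measure_singleton] at h
  have h1 := ENNReal.ofReal_eq_zero.1 h.symm
  have h2 := (monotone_cdf (gaussianReal 0 1)).leftLim_le (le_refl x)
  linarith

lemma cdf_quantile (v : ℝ) (h0 : 0 < v) (h1 : v < 1) :
    stdGaussianCDF (stdGaussianQuantile v) = v := by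
  apply Function.invFun_eq
  have hb : Tendsto stdGaussianCDF atBot (𝓝 0) := by
    rw [cdf_eq]; exact tendsto_cdf_atBot _
  have ht : Tendsto stdGaussianCDF atTop (𝓝 1) := by
    rw [cdf_eq]; exact tendsto_cdf_atTop _
  obtain ⟨x, hx⟩ := (hb.eventually_lt_const h0).exists
  obtain ⟨y, hy⟩ := (ht.eventually_const_lt h1).exists
  exact mem_range_of_exists_le_of_exists_ge cdf_cont ⟨x, hx.le⟩ ⟨y, hy.le⟩

lemma count_tendsto
    (p : ℕ → ℝ) (hp : ∀ n, p n ∈ Set.Icc (0 : ℝ) 1)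
    (a : ℕ → ℕ → ℝ)
    (ha0 : ∀ n, a n 0 = 0) (ha1 : ∀ n, a n (n + 1) = 1)
    (harec : ∀ n k, 1 ≤ n → 1 ≤ k → k ≤ n →
      a n k = p n * a (n - 1) (k - 1) + (1 - p n) * a (n - 1) k)
    (s : ℕ → ℝ) (hs : ∀ n, s n = ∑ k ∈ Finset.Icc 1 n, p k * (1 - p k))
    (hsinf : Tendsto s atTop atTop) (v : ℝ) (hv0 : 0 < v) (hv1 : v < 1)
    (R : ℕ → ℕ → Prop) [∀ n, DecidablePred (R n)]
    (hR1 : ∀ n k, a n k < v → R n k) (hR2 : ∀ n k, R n k → a n k ≤ v) :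
    Tendsto (fun n => ((((Finset.Icc 1 n).filter (R n)).card : ℝ) - mu p n) / Real.sqrt (s n))
      atTop (𝓝 (stdGaussianQuantile v)) := by
  have hnu := nu_eq p hp a ha0 ha1 harec
  have hsq : Tendsto (fun n => Real.sqrt (s n)) atTop atTop := Real.tendsto_sqrt_atTop.comp hsinf
  have hinv : Tendsto (fun n => (Real.sqrt (s n))⁻¹) atTop (𝓝 0) := hsq.inv_tendsto_atTop
  have hQ := cdf_quantile v hv0 hv1
  rw [tendsto_order]
  constructor
  · intro c hc
    obtain ⟨t, hct, htQ⟩ := exists_between hc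
    have hlt : stdGaussianCDF t < v := by rw [← hQ]; exact cdf_strictMono htQ
    filter_upwards [(clt p hp s hs hsinf t).eventually_lt_const hlt,
      hsq.eventually_gt_atTop 0, hinv.eventually_lt_const (sub_pos.2 hct)] with n h1 h2 h3
    have := nu_prob p hp n
    set T := mu p n + t * Real.sqrt (s n) with hT
    have hle : ∀ k ≤ n + 1, (k : ℝ) ≤ T → a n k < v := by
      intro k hk hkT
      rw [hnu n k hk]
      exact (measureReal_mono (fun x hx => (le_of_lt hx).trans hkT)).trans_lt h1
    have hTn : T < (n + 1 : ℕ) := by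
      by_contra! hh
      have := hle (n+1) le_rfl hh
      rw [ha1] at this; linarith
    have hcard : (⌊T⌋₊ : ℝ) ≤ (((Finset.Icc 1 n).filter (R n)).card : ℝ) := by
      have : Finset.Icc 1 ⌊T⌋₊ ⊆ (Finset.Icc 1 n).filter (R n) := by
        intro k hk
        rw [Finset.mem_Icc] at hk
        have hkT : (k : ℝ) ≤ T := (Nat.le_floor_iff' (by omega)).1 hk.2
        have hkn : k < n + 1 := by exact_mod_cast hkT.trans_lt hTn
        rw [Finset.mem_filter, Finset.mem_Icc]
        exact ⟨⟨hk.1, by omega⟩, hR1 _ _ (hle k hkn.le hkT)⟩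
      have := Finset.card_le_card this
      simp only [Nat.card_Icc, Nat.add_sub_cancel] at this
      exact_mod_cast this
    have hf := Nat.lt_floor_add_one T
    rw [lt_div_iff₀ h2]
    have h4 : 1 < (t - c) * Real.sqrt (s n) := by
      rwa [inv_lt_iff_one_lt_mul₀ h2] at h3
    nlinarith
  · intro c hc
    obtain ⟨t, htQ, hct⟩ := exists_between hc
    have hlt : v < stdGaussianCDF t := by rw [← hQ]; exact cdf_strictMono htQ
    filter_upwards [(clt p hp s hs hsinf t).eventually_const_lt hlt,
      hsq.eventually_gt_atTop 0] with n h1 h2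
    have := nu_prob p hp n
    set T := mu p n + t * Real.sqrt (s n) with hT
    have hle : ∀ k ≤ n + 1, T < (k : ℝ) → v < a n k := by
      intro k hk hkT
      rw [hnu n k hk]
      exact h1.trans_le (measureReal_mono (fun x hx => lt_of_le_of_lt hx hkT))
    have hT0 : 0 ≤ T := by
      by_contra! hh
      have := hle 0 (by omega) (by simpa using hh)
      rw [ha0] at this; linarith
    have hcard : (((Finset.Icc 1 n).filter (R n)).card : ℝ) ≤ ⌊T⌋₊ := by
      have : (Finset.Icc 1 n).filter (R n) ⊆ Finset.Icc 1 ⌊T⌋₊ := by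
        intro k hk
        rw [Finset.mem_filter, Finset.mem_Icc] at hk
        rw [Finset.mem_Icc]
        refine ⟨hk.1.1, Nat.le_floor ?_⟩
        by_contra! hh
        exact absurd (hR2 _ _ hk.2) (not_le.2 (hle k (by omega) hh))
      have := Finset.card_le_card this
      simp only [Nat.card_Icc, Nat.add_sub_cancel] at this
      exact_mod_cast this
    have hf := Nat.floor_le hT0
    rw [div_lt_iff₀ h2]
    nlinarith

end Strat

/-- Deterministic stratified fragmentation: if `s_n = ∑_{k=1}^n p_k(1-p_k) → ∞`, then
for all `0 < u ≤ v < 1`, `(n/√s_n)·g_n([u,v]) → Q(v) - Q(u)`. -/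
theorem stratified_bulk_convergence
    (p : ℕ → ℝ) (hp : ∀ n, p n ∈ Set.Icc (0 : ℝ) 1)
    (a : ℕ → ℕ → ℝ)
    (ha0 : ∀ n, a n 0 = 0) (ha1 : ∀ n, a n (n + 1) = 1)
    (harec : ∀ n k, 1 ≤ n → 1 ≤ k → k ≤ n →
      a n k = p n * a (n - 1) (k - 1) + (1 - p n) * a (n - 1) k)
    (s : ℕ → ℝ) (hs : ∀ n, s n = ∑ k ∈ Finset.Icc 1 n, p k * (1 - p k))
    (hsinf : Tendsto s atTop atTop) :
    ∀ u v : ℝ, 0 < u → u ≤ v → v < 1 →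
      Tendsto (fun n : ℕ =>
          (∑ k ∈ Finset.Icc 1 n, if u ≤ a n k ∧ a n k ≤ v then (1 : ℝ) else 0)
            / Real.sqrt (s n))
        atTop (𝓝 (stdGaussianQuantile v - stdGaussianQuantile u)) := by
  intro u v hu huv hv
  have h1 := Strat.count_tendsto p hp a ha0 ha1 harec s hs hsinf v (hu.trans_le huv) hv
    (fun n k => a n k ≤ v) (fun _ _ h => le_of_lt h) (fun _ _ h => h)
  have h2 := Strat.count_tendsto p hp a ha0 ha1 harec s hs hsinf u hu (huv.trans_lt hv)
    (fun n k => a n k < u) (fun _ _ h => h) (fun _ _ h => le_of_lt h)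
  refine (h1.sub h2).congr fun n => ?_
  rw [← sub_div]
  congr 1
  rw [sub_sub_sub_cancel_right, Finset.card_filter, Finset.card_filter]
  push_cast
  rw [← Finset.sum_sub_distrib]
  refine Finset.sum_congr rfl fun k _ => ?_
  by_cases ha : a n k < u
  · have h3 : a n k ≤ v := ha.le.trans huv
    simp [ha, h3]
  · simp [ha, not_lt.1 ha]
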